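/- Asymptotic behaviour at the terminal time (Corollary 3.2, equation (3.5)): if v : [0,T)×ℝ^d → ℝ is a nonnegative C^{1,2} function of polynomial growth satisfying v_t + Lv + F(y,v) = 0 on [0,T)×ℝ^d and v(t,y) → +∞ as t → T locally uniformly in y, then there exist constants C > 0 and δ ∈ (0,T) such that sup_{y∈ℝ^d} |(T−t)^{1/β} v(t,y) − η(y)| ≤ C(T−t) for all t ∈ [T−δ, T). -/

import Mathlib

open scoped BigOperators NNReal

noncomputable section

/-- `ℝ^d` as Euclidean space. -/
abbrev Euc (d : ℕ) : Type := EuclideanSpace ℝ (Fin d)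

/-- Partial derivative in the time variable, taken within the time set `s`. -/
noncomputable def partialT {d : ℕ} (s : Set ℝ) (w : ℝ → Euc d → ℝ) (t : ℝ) (y : Euc d) : ℝ :=
  derivWithin (fun r => w r y) s t

/-- `i`-th partial derivative in the space variable. -/
noncomputable def gradY {d : ℕ} (w : ℝ → Euc d → ℝ) (t : ℝ) (y : Euc d) (i : Fin d) : ℝ :=
  fderiv ℝ (w t) y (EuclideanSpace.single i 1)

/-- `(i,j)` entry of the Hessian in the space variable. -/
noncomputable def hessY {d : ℕ} (w : ℝ → Euc d → ℝ) (t : ℝ) (y : Euc d) (i j : Fin d) : ℝ :=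
  fderiv ℝ (fun z => fderiv ℝ (w t) z (EuclideanSpace.single j 1)) y (EuclideanSpace.single i 1)

/-- The operator `L w = ½ tr(σσᵀ D²_y w) + ⟨b, D_y w⟩`. -/
noncomputable def Lop {d n : ℕ} (b : Euc d → Euc d) (σ : Euc d → Matrix (Fin d) (Fin n) ℝ)
    (w : ℝ → Euc d → ℝ) (t : ℝ) (y : Euc d) : ℝ :=
  (1 / 2) * ∑ i, ∑ j, (∑ k, σ y i k * σ y j k) * hessY w t y i j
    + ∑ i, b y i * gradY w t y i

/-- The nonlinearity `F(y,v) = λ(y) − v^{β+1}/(β η(y)^β) + θγ(y)v/(γ(y)^β+v^β)^{1/β} − θv`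
with `β = 1/(p−1)` (so `1/β = p−1`); by Lean's conventions the third term is `0` when
`γ(y) = v = 0`. -/
noncomputable def hjbF {d : ℕ} (p θ : ℝ) (η lam gam : Euc d → ℝ) (y : Euc d) (v : ℝ) : ℝ :=
  lam y - v ^ (1 / (p - 1) + 1) / ((1 / (p - 1)) * η y ^ (1 / (p - 1)))
    + θ * gam y * v / ((gam y ^ (1 / (p - 1)) + v ^ (1 / (p - 1))) ^ (p - 1))
    - θ * v

/-- `w` is `C^{1,2}` on `s × ℝ^d`: differentiable in time (within `s`), twice continuously
differentiable in space, with `w`, `∂_t w` and the spatial derivatives jointly continuous. -/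
def IsC12On {d : ℕ} (s : Set ℝ) (w : ℝ → Euc d → ℝ) : Prop :=
  (∀ t ∈ s, ∀ y, DifferentiableWithinAt ℝ (fun r => w r y) s t) ∧
  (∀ t ∈ s, ContDiff ℝ 2 (w t)) ∧
  ContinuousOn (fun q : ℝ × Euc d => w q.1 q.2) (s ×ˢ Set.univ) ∧
  ContinuousOn (fun q : ℝ × Euc d => partialT s w q.1 q.2) (s ×ˢ Set.univ) ∧
  ContinuousOn (fun q : ℝ × Euc d => fderiv ℝ (fun z => fderiv ℝ (w q.1) z) q.2) (s ×ˢ Set.univ)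

/-- `w(t,y) → +∞` as `t → T`, locally uniformly in `y`, with `t` ranging in `[a,T)`. -/
def BlowsUpLocUnif {d : ℕ} (a T : ℝ) (w : ℝ → Euc d → ℝ) : Prop :=
  ∀ K : Set (Euc d), IsCompact K → ∀ M : ℝ,
    ∃ t₀, a ≤ t₀ ∧ t₀ < T ∧ ∀ t, t₀ ≤ t → t < T → ∀ y ∈ K, M ≤ w t y

/-- Polynomial growth on `[a,T) × ℝ^d`: for each `s < T` a bound `C(1+‖y‖^q)` on `[a,s]`. -/
def PolyGrowthOn {d : ℕ} (a T : ℝ) (w : ℝ → Euc d → ℝ) : Prop :=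
  ∀ s, a ≤ s → s < T → ∃ C > 0, ∃ q > 0,
    ∀ t, a ≤ t → t ≤ s → ∀ y : Euc d, |w t y| ≤ C * (1 + ‖y‖ ^ q)

/-- columns of sigma -/
def colV {d n : ℕ} (σ : Euc d → Matrix (Fin d) (Fin n) ℝ) (y : Euc d) (k : Fin n) : Euc d :=
  ∑ i, σ y i k • EuclideanSpace.single i (1 : ℝ)

/-- the operator in terms of Frechet derivatives -/
def LL {d n : ℕ} (b : Euc d → Euc d) (σ : Euc d → Matrix (Fin d) (Fin n) ℝ)
    (f : Euc d → ℝ) (y : Euc d) : ℝ :=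
  (1 / 2) * ∑ k, fderiv ℝ (fderiv ℝ f) y (colV σ y k) (colV σ y k) + fderiv ℝ f y (b y)

lemma diff1 {d : ℕ} {f : Euc d → ℝ} (hf : ContDiff ℝ 2 f) : Differentiable ℝ f :=
  hf.differentiable (by norm_num)

lemma diff2 {d : ℕ} {f : Euc d → ℝ} (hf : ContDiff ℝ 2 f) : Differentiable ℝ (fderiv ℝ f) :=
  (hf.fderiv_right (m := 1) (by norm_num)).differentiable (by norm_num)

lemma euc_sum {d : ℕ} (x : Euc d) : x = ∑ i, x i • EuclideanSpace.single i (1 : ℝ) := by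
  ext j
  simp [Finset.sum_apply, Pi.single_apply]

lemma Lop_eq {d n : ℕ} (b : Euc d → Euc d) (σ : Euc d → Matrix (Fin d) (Fin n) ℝ)
    (w : ℝ → Euc d → ℝ) (t : ℝ) (y : Euc d) (hf : ContDiff ℝ 2 (w t)) :
    Lop b σ w t y = LL b σ (w t) y := by
  have h2 := diff2 hf
  have hH : ∀ i j, hessY w t y i j = fderiv ℝ (fderiv ℝ (w t)) y (EuclideanSpace.single i 1)
      (EuclideanSpace.single j 1) := by
    intro i j
    unfold hessY
    rw [fderiv_clm_apply (h2 y) (by fun_prop)]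
    simp
  unfold Lop LL
  congr 1
  · congr 1
    simp only [colV, map_sum, sum_apply, map_smul, hH,
      smul_apply, smul_eq_mul, Finset.sum_mul]
    simp only [Finset.mul_sum]
    conv_lhs => enter [2, x]; rw [Finset.sum_comm]
    rw [Finset.sum_comm]
    refine Finset.sum_congr rfl fun k _ => ?_
    refine Finset.sum_congr rfl fun i _ => ?_
    refine Finset.sum_congr rfl fun j _ => ?_
    have hs : fderiv ℝ (fderiv ℝ (w t)) y (EuclideanSpace.single i 1) (EuclideanSpace.single j 1) = fderiv ℝ (fderiv ℝ (w t)) y (EuclideanSpace.single j 1) (EuclideanSpace.single i 1) :=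
      (hf.contDiffAt.isSymmSndFDerivAt (by simp)).eq _ _
    rw [hs]; ring
  · conv_rhs => rw [euc_sum (b y)]
    simp [gradY]

lemma LL_comb {d n : ℕ} (b : Euc d → Euc d) (σ : Euc d → Matrix (Fin d) (Fin n) ℝ)
    {f g h : Euc d → ℝ} (hf : ContDiff ℝ 2 f) (hg : ContDiff ℝ 2 g) (hh : ContDiff ℝ 2 h)
    (a c e k : ℝ) (y : Euc d) :
    LL b σ (fun y => a * f y + c * g y + e * h y + k) y
      = a * LL b σ f y + c * LL b σ g y + e * LL b σ h y := by
  have h1 : fderiv ℝ (fun y => a * f y + c * g y + e * h y + k) =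
      fun y => a • fderiv ℝ f y + c • fderiv ℝ g y + e • fderiv ℝ h y := by
    funext z
    exact (((((diff1 hf z).hasFDerivAt.const_mul a).add
      ((diff1 hg z).hasFDerivAt.const_mul c)).add
      ((diff1 hh z).hasFDerivAt.const_mul e)).add_const k).fderiv
  have h2 : fderiv ℝ (fun y => a • fderiv ℝ f y + c • fderiv ℝ g y + e • fderiv ℝ h y) y =
      a • fderiv ℝ (fderiv ℝ f) y + c • fderiv ℝ (fderiv ℝ g) y + e • fderiv ℝ (fderiv ℝ h) y := by
    exact ((((diff2 hf y).hasFDerivAt.const_smul a).add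
      ((diff2 hg y).hasFDerivAt.const_smul c)).add
      ((diff2 hh y).hasFDerivAt.const_smul e)).fderiv
  unfold LL
  rw [h1, h2]
  simp only [add_apply, smul_apply, smul_eq_mul,
    Finset.sum_add_distrib, ← Finset.mul_sum]
  ring

lemma second_nonneg {g : ℝ → ℝ} (hg : ContDiff ℝ 2 g) {x : ℝ} (hx : IsLocalMin g x) :
    0 ≤ deriv (deriv g) x := by
  by_contra! hlt
  have hd : deriv g x = 0 := hx.deriv_eq_zero
  have hmax : IsLocalMax g x := isLocalMax_of_deriv_deriv_neg hlt hd hg.continuous.continuousAt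
  have hc : g =ᶠ[nhds x] fun _ => g x := by
    filter_upwards [hx, hmax] with z h1 h2
    exact le_antisymm h2 h1
  have h1 : deriv g =ᶠ[nhds x] deriv (fun _ => g x) := hc.deriv
  have h2 := h1.deriv_eq
  simp at h2
  linarith

lemma LL_nonneg_of_min {d n : ℕ} (b : Euc d → Euc d) (σ : Euc d → Matrix (Fin d) (Fin n) ℝ)
    {f : Euc d → ℝ} (hf : ContDiff ℝ 2 f) {y : Euc d} (hy : ∀ z, f y ≤ f z) :
    0 ≤ LL b σ f y := by
  have hmin : IsLocalMin f y := Filter.Eventually.of_forall hy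
  have h0 : fderiv ℝ f y = 0 := hmin.fderiv_eq_zero
  have key : ∀ s : Euc d, 0 ≤ fderiv ℝ (fderiv ℝ f) y s s := by
    intro s
    have hl : ∀ r : ℝ, HasDerivAt (fun r : ℝ => y + r • s) s r := by
      intro r
      simpa using ((hasDerivAt_id r).smul_const s).const_add y
    have hd1 : deriv (fun r : ℝ => f (y + r • s)) = fun r => fderiv ℝ f (y + r • s) s := by
      funext r
      exact ((diff1 hf _).hasFDerivAt.comp_hasDerivAt r (hl r)).deriv
    have hd2 : deriv (fun r : ℝ => fderiv ℝ f (y + r • s) s) 0 = fderiv ℝ (fderiv ℝ f) y s s := by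
      have hG : HasFDerivAt (fun z => fderiv ℝ f z s) (fderiv ℝ (fun z => fderiv ℝ f z s) (y + (0:ℝ) • s))
          (y + (0:ℝ) • s) :=
        ((diff2 hf _).clm_apply (differentiableAt_const s)).hasFDerivAt
      have h1 := (hG.comp_hasDerivAt 0 (hl 0)).deriv
      refine h1.trans ?_
      rw [zero_smul, add_zero, fderiv_clm_apply (diff2 hf y) (by fun_prop)]
      simp
    have := second_nonneg (g := fun r : ℝ => f (y + r • s)) (x := 0)
      (hf.comp (by fun_prop)) (Filter.Eventually.of_forall fun r => by simpa using hy _)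
    rw [hd1, hd2] at this
    exact this
  unfold LL
  rw [h0]
  have := Finset.sum_nonneg (s := Finset.univ) fun k (_ : k ∈ Finset.univ) => key (colV σ y k)
  simp
  linarith

lemma min_principle {d n : ℕ} (b : Euc d → Euc d) (σ : Euc d → Matrix (Fin d) (Fin n) ℝ)
    (φ : ℝ → Euc d → ℝ) (t1 U : ℝ)
    (hC2 : ∀ t, t1 ≤ t → t < U → ContDiff ℝ 2 (φ t))
    (hcont : ContinuousOn (fun q : ℝ × Euc d => φ q.1 q.2) (Set.Ico t1 U ×ˢ Set.univ))
    (R s : ℝ) (hs : s < U)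
    (hR : ∀ t y, t1 ≤ t → t < U → R ≤ ‖y‖ → 0 < φ t y)
    (hS : ∀ t y, s ≤ t → t1 ≤ t → t < U → ‖y‖ ≤ R → 0 < φ t y)
    (hpde : ∀ t y, t1 ≤ t → t < U → φ t y ≤ 0 →
      ∃ D, HasDerivAt (fun r => φ r y) D t ∧ D + LL b σ (φ t) y < 0) :
    ∀ t y, t1 ≤ t → t < U → 0 < φ t y := by
  intro t y ht1 htU
  by_contra! hneg
  have hpos : ∀ t y, t1 ≤ t → t < U → φ t y ≤ 0 → t ≤ s ∧ ‖y‖ ≤ R := by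
    intro t y h1 h2 h3
    have hy : ‖y‖ ≤ R := by
      by_contra! h
      linarith [hR t y h1 h2 h.le]
    refine ⟨?_, hy⟩
    by_contra! h
    linarith [hS t y h.le h1 h2 hy]
  have hK : IsCompact (Set.Icc t1 s ×ˢ Metric.closedBall (0 : Euc d) R) :=
    isCompact_Icc.prod (isCompact_closedBall _ _)
  have hmem : (t, y) ∈ Set.Icc t1 s ×ˢ Metric.closedBall (0 : Euc d) R := by
    obtain ⟨h1, h2⟩ := hpos t y ht1 htU hneg
    exact ⟨⟨ht1, h1⟩, by simpa using h2⟩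
  obtain ⟨⟨t0, y0⟩, hm0, hmin⟩ := hK.exists_isMinOn ⟨_, hmem⟩ (hcont.mono (by
    rintro ⟨a, c⟩ ⟨h1, -⟩
    exact ⟨⟨h1.1, lt_of_le_of_lt h1.2 hs⟩, trivial⟩))
  have h00 : φ t0 y0 ≤ φ t y := hmin hmem
  have hle : φ t0 y0 ≤ 0 := h00.trans hneg
  have ht0 : t1 ≤ t0 := hm0.1.1
  have ht0U : t0 < U := lt_of_le_of_lt hm0.1.2 hs
  have hglob : ∀ t y, t1 ≤ t → t < U → φ t0 y0 ≤ φ t y := by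
    intro t y h1 h2
    by_cases h : φ t y ≤ 0
    · obtain ⟨h3, h4⟩ := hpos t y h1 h2 h
      exact hmin (show (t, y) ∈ _ from ⟨⟨h1, h3⟩, by simpa using h4⟩)
    · push Not at h
      linarith
  obtain ⟨D, hD, hlt⟩ := hpde t0 y0 ht0 ht0U hle
  have hL := LL_nonneg_of_min b σ (hC2 t0 ht0 ht0U) (fun z => hglob t0 z ht0 ht0U)
  have hDneg : D < 0 := by linarith
  have hslope := hD.tendsto_slope
  have hsl : Filter.Tendsto (slope (fun r => φ r y0) t0) (nhdsWithin t0 (Set.Ioi t0)) (nhds D) :=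
    hslope.mono_left (nhdsWithin_mono _ (by intro x hx; exact ne_of_gt hx))
  have hge : 0 ≤ D := by
    refine ge_of_tendsto hsl ?_
    filter_upwards [Ioo_mem_nhdsGT ht0U] with r hr
    rw [slope_def_field]
    exact div_nonneg (sub_nonneg.2 (hglob r y0 (ht0.trans hr.1.le) hr.2)) (by linarith [hr.1])
  linarith

lemma colV_norm {d n : ℕ} {σ : Euc d → Matrix (Fin d) (Fin n) ℝ} {C : ℝ}
    (hσ : ∀ y i k, |σ y i k| ≤ C) (y : Euc d) (k : Fin n) : ‖colV σ y k‖ ≤ d * C := by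
  unfold colV
  refine (norm_sum_le _ _).trans ?_
  calc _ ≤ ∑ i : Fin d, C := Finset.sum_le_sum fun i _ => by
        rw [norm_smul]; simpa using hσ y i k
    _ = d * C := by simp

lemma LL_bound {d n : ℕ} {b : Euc d → Euc d} {σ : Euc d → Matrix (Fin d) (Fin n) ℝ} {C Cb Cf : ℝ}
    (hσ : ∀ y i k, |σ y i k| ≤ C) (hb : ∀ y, ‖b y‖ ≤ Cb) {f : Euc d → ℝ}
    (hf1 : ∀ y, ‖fderiv ℝ f y‖ ≤ Cf) (hf2 : ∀ y, ‖fderiv ℝ (fderiv ℝ f) y‖ ≤ Cf) :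
    ∃ M, 0 ≤ M ∧ ∀ y, |LL b σ f y| ≤ M := by
  have hCf : 0 ≤ Cf := (norm_nonneg _).trans (hf1 0)
  refine ⟨(1/2) * (n * (Cf * (d * C) * (d * C))) + Cf * Cb, ?_, fun y => ?_⟩
  · have : 0 ≤ Cb := (norm_nonneg _).trans (hb 0)
    have h2 : 0 ≤ Cf * (d * C) * (d * C) := by
      rw [mul_assoc]; exact mul_nonneg hCf (mul_self_nonneg _)
    positivity
  unfold LL
  refine (abs_add_le _ _).trans (add_le_add ?_ ?_)
  · rw [abs_mul, abs_of_pos (by norm_num : (0:ℝ) < 1/2)]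
    refine mul_le_mul_of_nonneg_left ?_ (by norm_num)
    refine (Finset.abs_sum_le_sum_abs _ _).trans ?_
    calc _ ≤ ∑ k : Fin n, Cf * (d * C) * (d * C) := Finset.sum_le_sum fun k _ => by
          have h1 := ContinuousLinearMap.le_opNorm₂ (fderiv ℝ (fderiv ℝ f) y) (colV σ y k) (colV σ y k)
          rw [Real.norm_eq_abs] at h1
          have h2 := colV_norm hσ y k
          have h3 := hf2 y
          refine h1.trans ?_
          have : 0 ≤ d * C := (norm_nonneg _).trans h2
          gcongr
      _ = _ := by simp
  · have h1 := ContinuousLinearMap.le_opNorm (fderiv ℝ f y) (b y)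
    rw [Real.norm_eq_abs] at h1
    refine h1.trans ?_
    have := hb y
    have := hf1 y
    gcongr

/-- sum of cosh of the coordinates -/
def gch {d : ℕ} (y : Euc d) : ℝ := ∑ i, Real.cosh (y i)

lemma gch_C2 {d : ℕ} : ContDiff ℝ 2 (gch (d := d)) := by
  unfold gch
  fun_prop

lemma gch_fderiv {d : ℕ} (y s : Euc d) : fderiv ℝ gch y s = ∑ i, Real.sinh (y i) * s i := by
  have : HasFDerivAt (gch (d := d))
      (∑ i, Real.sinh (y i) • (EuclideanSpace.proj i : Euc d →L[ℝ] ℝ)) y := by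
    unfold gch
    refine HasFDerivAt.fun_sum fun i _ => ?_
    exact ((EuclideanSpace.proj i : Euc d →L[ℝ] ℝ).hasFDerivAt (x := y)).cosh
  rw [this.fderiv]
  simp

lemma gch_fderiv2 {d : ℕ} (y s : Euc d) :
    fderiv ℝ (fderiv ℝ gch) y s s = ∑ i, Real.cosh (y i) * s i * s i := by
  have h1 : fderiv ℝ (fun z => fderiv ℝ gch z s) y s = fderiv ℝ (fderiv ℝ gch) y s s := by
    rw [fderiv_clm_apply (diff2 gch_C2 y) (by fun_prop)]
    simp
  rw [← h1]
  have : HasFDerivAt (fun z : Euc d => fderiv ℝ gch z s)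
      (∑ i, s i • (Real.cosh (y i) • (EuclideanSpace.proj i : Euc d →L[ℝ] ℝ))) y := by
    simp only [gch_fderiv]
    refine HasFDerivAt.fun_sum fun i _ => ?_
    exact ((EuclideanSpace.proj i : Euc d →L[ℝ] ℝ).hasFDerivAt (x := y)).sinh.mul_const (s i)
  rw [this.fderiv]
  simp
  exact Finset.sum_congr rfl fun i _ => by ring

lemma gch_pos {d : ℕ} (y : Euc d) : 0 ≤ gch y :=
  Finset.sum_nonneg fun i _ => (Real.cosh_pos _).le

lemma gch_LL {d n : ℕ} {b : Euc d → Euc d} {σ : Euc d → Matrix (Fin d) (Fin n) ℝ} {C Cb : ℝ}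
    (hσ : ∀ y i k, |σ y i k| ≤ C) (hb : ∀ y, ‖b y‖ ≤ Cb) :
    ∃ K, ∀ y, LL b σ gch y ≤ K * gch y := by
  refine ⟨(1/2) * (n * (C * C)) + Cb, fun y => ?_⟩
  unfold LL
  rw [add_mul, mul_assoc]
  refine add_le_add (mul_le_mul_of_nonneg_left ?_ (by norm_num)) ?_
  · calc _ ≤ ∑ k : Fin n, (C * C) * gch y := Finset.sum_le_sum fun k _ => by
          rw [gch_fderiv2, gch, Finset.mul_sum]
          refine Finset.sum_le_sum fun i _ => ?_
          have h1 : colV σ y k i = σ y i k := by simp [colV, Finset.sum_apply, Pi.single_apply]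
          rw [h1]
          have h2 := hσ y i k
          have h3 : σ y i k * σ y i k ≤ C * C := by
            rw [← abs_mul_abs_self]
            exact mul_self_le_mul_self (abs_nonneg _) h2
          nlinarith [Real.cosh_pos (y i)]
      _ = _ := by simp; ring
  · rw [gch_fderiv, gch, Finset.mul_sum]
    refine Finset.sum_le_sum fun i _ => ?_
    have h1 : |b y i| ≤ Cb := by
      have := PiLp.norm_apply_le (b y) i
      rw [Real.norm_eq_abs] at this
      exact this.trans (hb y)
    have h2 : |Real.sinh (y i)| ≤ Real.cosh (y i) := by
      rw [← Real.cosh_abs, Real.abs_sinh]; exact (Real.sinh_lt_cosh _).le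
    calc _ ≤ |Real.sinh (y i) * b y i| := le_abs_self _
      _ ≤ Real.cosh (y i) * Cb := by rw [abs_mul]; gcongr
      _ = _ := by ring

lemma gch_large {d : ℕ} (hd : 1 ≤ d) (y : Euc d) : Real.exp (‖y‖ / d) / 2 ≤ gch y := by
  have : Nonempty (Fin d) := ⟨⟨0, hd⟩⟩
  have hd' : (0:ℝ) < d := by exact_mod_cast hd
  have h1 : ‖y‖ ≤ ∑ i, |y i| := by
    conv_lhs => rw [euc_sum y]
    refine (norm_sum_le _ _).trans (Finset.sum_le_sum fun i _ => ?_)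
    rw [norm_smul]; simp
  obtain ⟨i, -, hi⟩ := Finset.exists_le_of_sum_le (s := Finset.univ)
    (f := fun _ : Fin d => ‖y‖ / d) (g := fun i => |y i|) Finset.univ_nonempty (by
      simp; rw [mul_div_cancel₀ _ hd'.ne']; exact h1)
  have h2 : Real.cosh (y i) ≤ gch y :=
    Finset.single_le_sum (f := fun i => Real.cosh (y i)) (fun i _ => (Real.cosh_pos _).le)
      (Finset.mem_univ i)
  refine le_trans ?_ h2
  rw [← Real.cosh_abs, Real.cosh_eq]
  have := Real.exp_le_exp.2 hi
  have := Real.exp_pos (-|y i|)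
  linarith

lemma gch_dom {d : ℕ} (hd : 1 ≤ d) (ε C : ℝ) (hε : 0 < ε) (q : ℕ) :
    ∃ R : ℝ, 0 ≤ R ∧ ∀ y : Euc d, R ≤ ‖y‖ → C * (1 + ‖y‖ ^ q) < ε * gch y := by
  have hd' : (0:ℝ) < d := by exact_mod_cast hd
  have hlim : Filter.Tendsto (fun x : ℝ => C * (1 + x ^ q) / Real.exp (x * (1 / d)))
      Filter.atTop (nhds 0) := by
    have h0 := (isLittleO_pow_exp_pos_mul_atTop (k := 0) (b := (1:ℝ)/d) (by positivity)).tendsto_div_nhds_zero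
    have h1 := (isLittleO_pow_exp_pos_mul_atTop (k := q) (b := (1:ℝ)/d) (by positivity)).tendsto_div_nhds_zero
    have := (h0.add h1).const_mul C
    simp only [add_zero, mul_zero] at this
    refine this.congr fun x => ?_
    rw [mul_comm x]
    simp only [pow_zero]
    ring
  have hev := (hlim.eventually (gt_mem_nhds (show (0:ℝ) < ε / 2 by positivity)))
  obtain ⟨R, hR⟩ := Filter.eventually_atTop.1 hev
  refine ⟨max R 0, le_max_right _ _, fun y hy => ?_⟩
  have h := hR ‖y‖ ((le_max_left _ _).trans hy)
  rw [div_lt_iff₀ (Real.exp_pos _)] at h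
  have h2 := gch_large hd y
  rw [mul_one_div] at h
  nlinarith

/-- difference of solution and barrier, with penalization -/
def phi {d : ℕ} (η : Euc d → ℝ) (v : ℝ → Euc d → ℝ) (a S C K ε e : ℝ) (t : ℝ) (y : Euc d) : ℝ :=
  (-e * (S - t) ^ (-a)) * η y + (ε * Real.exp (-K * t)) * gch y + e * v t y
    + C * ((S - t) ^ (-a) * (S - t))

lemma core {d n : ℕ} {b : Euc d → Euc d} {σ : Euc d → Matrix (Fin d) (Fin n) ℝ}
    {η : Euc d → ℝ} (hη : ContDiff ℝ 2 η) {v vt : ℝ → Euc d → ℝ} {t1 U S a C K ε e : ℝ}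
    (hUS : U ≤ S) (hε : 0 < ε)
    (hK : ∀ y, LL b σ gch y ≤ K * gch y)
    (hvC2 : ∀ t, t1 ≤ t → t < U → ContDiff ℝ 2 (v t))
    (hvcont : ContinuousOn (fun q : ℝ × Euc d => v q.1 q.2) (Set.Ico t1 U ×ˢ Set.univ))
    (hvt : ∀ t y, t1 ≤ t → t < U → HasDerivAt (fun r => v r y) (vt t y) t)
    (R s : ℝ) (hs : s < U)
    (hR : ∀ t y, t1 ≤ t → t < U → R ≤ ‖y‖ → 0 < phi η v a S C K ε e t y)
    (hS : ∀ t y, s ≤ t → t1 ≤ t → t < U → ‖y‖ ≤ R → 0 < phi η v a S C K ε e t y)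
    (hineq : ∀ t y, t1 ≤ t → t < U → phi η v a S C K ε e t y ≤ 0 →
      e * (vt t y + LL b σ (v t) y) - e * (a * (S - t) ^ (-a - 1) * η y
        + (S - t) ^ (-a) * LL b σ η y)
        + C * (a * (S - t) ^ (-a - 1) * (S - t) - (S - t) ^ (-a)) < 0) :
    ∀ t y, t1 ≤ t → t < U → 0 < phi η v a S C K ε e t y := by
  refine min_principle b σ _ t1 U ?_ ?_ R s hs hR hS ?_
  · intro t h1 h2
    have := hvC2 t h1 h2
    have := gch_C2 (d := d)
    unfold phi
    fun_prop
  · unfold phi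
    have hpow : ContinuousOn (fun q : ℝ × Euc d => (S - q.1) ^ (-a)) (Set.Ico t1 U ×ˢ Set.univ) := by
      refine ContinuousOn.rpow_const (by fun_prop) ?_
      rintro ⟨t, y⟩ ⟨ht, -⟩
      left
      have := ht.2
      simp only at *
      linarith
    have hη' : Continuous η := hη.continuous
    have hg' : Continuous (gch (d := d)) := gch_C2.continuous
    have h1 : ContinuousOn (fun q : ℝ × Euc d => η q.2) (Set.Ico t1 U ×ˢ Set.univ) := by fun_prop
    have h2 : ContinuousOn (fun q : ℝ × Euc d => gch q.2) (Set.Ico t1 U ×ˢ Set.univ) := by fun_prop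
    have h3 : ContinuousOn (fun q : ℝ × Euc d => ε * Real.exp (-K * q.1)) (Set.Ico t1 U ×ˢ Set.univ) := by
      fun_prop
    have h4 : ContinuousOn (fun q : ℝ × Euc d => S - q.1) (Set.Ico t1 U ×ˢ Set.univ) := by
      fun_prop
    exact ((((continuousOn_const.mul hpow).mul h1).add (h3.mul h2)).add
      (continuousOn_const.mul hvcont)).add (continuousOn_const.mul (hpow.mul h4))
  · intro t y h1 h2 h3
    have hτ : 0 < S - t := by linarith
    have hin := hineq t y h1 h2 h3
    have hd0 : HasDerivAt (fun r => S - r) (-1) t := by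
      simpa using (hasDerivAt_id t).const_sub S
    have hd1 : HasDerivAt (fun r => (S - r) ^ (-a)) (a * (S - t) ^ (-a - 1)) t := by
      have := hd0.rpow_const (p := -a) (Or.inl hτ.ne')
      convert this using 1
      ring
    have hd2 : HasDerivAt (fun r => ε * Real.exp (-K * r)) (ε * (Real.exp (-K * t) * (-K))) t := by
      have : HasDerivAt (fun r : ℝ => -K * r) (-K) t := by
        simpa using (hasDerivAt_id t).const_mul (-K)
      exact this.exp.const_mul ε
    have hD := (((((hd1.const_mul (-e)).mul_const (η y)).add (hd2.mul_const (gch y))).add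
      ((hvt t y h1 h2).const_mul e)).add ((hd1.mul hd0).const_mul C))
    refine ⟨_, hD, ?_⟩
    have hL : LL b σ (phi η v a S C K ε e t) y = _ :=
      LL_comb b σ hη gch_C2 (hvC2 t h1 h2) (-e * (S - t) ^ (-a)) (ε * Real.exp (-K * t)) e
        (C * ((S - t) ^ (-a) * (S - t))) y
    rw [hL]
    have hk := hK y
    have hpos : 0 < ε * Real.exp (-K * t) := by positivity
    have := mul_le_mul_of_nonneg_left hk hpos.le
    linarith

lemma pow_split {τ u a : ℝ} (hτ : 0 < τ) (hu : 0 ≤ u) (ha : 0 < a) :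
    (τ ^ (-a) * u) ^ (1 / a + 1) = τ ^ (-a - 1) * (u * u ^ (1 / a)) := by
  rw [Real.mul_rpow (by positivity) hu, ← Real.rpow_mul hτ.le]
  congr 1
  · congr 1
    field_simp
    ring
  · rw [Real.rpow_add_one' hu (by positivity)]
    ring

lemma third_bds {a θ g x : ℝ} (ha : 0 < a) (hθ : 0 ≤ θ) (hg : 0 ≤ g) (hx : 0 ≤ x) :
    0 ≤ θ * g * x / ((g ^ (1 / a) + x ^ (1 / a)) ^ a) ∧
    θ * g * x / ((g ^ (1 / a) + x ^ (1 / a)) ^ a) ≤ θ * x := by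
  refine ⟨by positivity, ?_⟩
  refine div_le_of_le_mul₀ (by positivity) (by positivity) ?_
  have h : g ≤ (g ^ (1 / a) + x ^ (1 / a)) ^ a := by
    calc g = (g ^ (1 / a)) ^ a := by
          rw [← Real.rpow_mul hg, one_div_mul_cancel ha.ne', Real.rpow_one]
      _ ≤ _ := by
          apply Real.rpow_le_rpow (by positivity) _ ha.le
          have : 0 ≤ x ^ (1 / a) := by positivity
          linarith
  have : 0 ≤ θ * x := by positivity
  nlinarith

lemma super_alg {τ u x h a : ℝ} (hτ : 0 < τ) (ha : 0 < a) (hh : 0 < h) (hu : h ≤ u)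
    (hx : τ ^ (-a) * u ≤ x) :
    a * τ ^ (-a - 1) * u ≤ x ^ (1 / a + 1) / ((1 / a) * h ^ (1 / a)) := by
  have hu0 : 0 < u := hh.trans_le hu
  have h1 : (τ ^ (-a) * u) ^ (1 / a + 1) ≤ x ^ (1 / a + 1) :=
    Real.rpow_le_rpow (by positivity) hx (by positivity)
  rw [pow_split hτ hu0.le ha] at h1
  have h2 : h ^ (1 / a) ≤ u ^ (1 / a) := Real.rpow_le_rpow hh.le hu (by positivity)
  rw [le_div_iff₀ (by positivity)]
  have h3 : a * τ ^ (-a - 1) * u * (1 / a * h ^ (1 / a)) = τ ^ (-a - 1) * (u * h ^ (1 / a)) := by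
    field_simp
  rw [h3]
  refine le_trans ?_ h1
  gcongr

lemma sub_alg {τ u x h a : ℝ} (hτ : 0 < τ) (ha : 0 < a) (hh : 0 < h) (hu : u ≤ h) (hu0 : 0 ≤ u)
    (hx0 : 0 ≤ x) (hx : x ≤ τ ^ (-a) * u) :
    x ^ (1 / a + 1) / ((1 / a) * h ^ (1 / a)) ≤ a * τ ^ (-a - 1) * u := by
  have h1 : x ^ (1 / a + 1) ≤ (τ ^ (-a) * u) ^ (1 / a + 1) :=
    Real.rpow_le_rpow (by positivity) hx (by positivity)
  rw [pow_split hτ hu0 ha] at h1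
  have h2 : u ^ (1 / a) ≤ h ^ (1 / a) := Real.rpow_le_rpow hu0 hu (by positivity)
  rw [div_le_iff₀ (by positivity)]
  have h3 : a * τ ^ (-a - 1) * u * (1 / a * h ^ (1 / a)) = τ ^ (-a - 1) * (u * h ^ (1 / a)) := by
    field_simp
  rw [h3]
  refine h1.trans ?_
  gcongr

lemma limit_arg {η v a C t T g D : ℝ} {e : ℝ} (ht : t < T) (P : Set ℝ)
    [hne : (nhdsWithin T P).NeBot]
    (h : ∀ᶠ S in nhdsWithin T P, ∀ ε > 0,
      0 < (-e * (S - t) ^ (-a)) * η + (ε * D) * g + e * v + C * ((S - t) ^ (-a) * (S - t))) :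
    0 ≤ e * ((T - t) ^ a * v - η) + C * (T - t) := by
  have hτ : 0 < T - t := by linarith
  have h1 : ∀ᶠ S in nhdsWithin T P,
      0 ≤ (-e * (S - t) ^ (-a)) * η + e * v + C * ((S - t) ^ (-a) * (S - t)) := by
    filter_upwards [h] with S hS
    by_contra! hneg
    set X := (-e * (S - t) ^ (-a)) * η + e * v + C * ((S - t) ^ (-a) * (S - t)) with hX
    have hε : 0 < -X / (2 * (|D * g| + 1)) := div_pos (by linarith) (by positivity)
    have h2 := hS _ hε
    have h3 : -X / (2 * (|D * g| + 1)) * (D * g) ≤ -X / 2 := by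
      rw [div_mul_eq_mul_div, div_le_iff₀ (by positivity)]
      nlinarith [le_abs_self (D * g)]
    nlinarith
  have hc : ContinuousAt (fun S => (-e * (S - t) ^ (-a)) * η + e * v + C * ((S - t) ^ (-a) * (S - t))) T := by
    have : ContinuousAt (fun S => (S - t) ^ (-a)) T :=
      ContinuousAt.rpow_const (by fun_prop) (Or.inl hτ.ne')
    fun_prop
  have h2 := ge_of_tendsto (hc.tendsto.mono_left nhdsWithin_le_nhds) h1
  have h3 : (T - t) ^ (-a) * (T - t) ^ a = 1 := by
    rw [← Real.rpow_add hτ]; simp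
  have h4 : 0 ≤ (T - t) ^ a := by positivity
  have h5 := mul_nonneg h4 h2
  have : (T - t) ^ a * ((-e * (T - t) ^ (-a)) * η + e * v + C * ((T - t) ^ (-a) * (T - t)))
      = e * ((T - t) ^ a * v - ((T - t) ^ (-a) * (T - t) ^ a) * η)
        + C * ((T - t) ^ (-a) * (T - t) ^ a) * (T - t) := by ring
  rw [this, h3] at h5
  simpa using h5
/-- Corollary 3.2, eq. (3.5): any nonnegative `C^{1,2}` solution of
polynomial growth to the singular terminal value problem satisfies
`sup_y |(T−t)^{1/β} v(t,y) − η(y)| ≤ C (T−t)` near the terminal time, where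
`1/β = p − 1`. -/
theorem terminal_asymptotics
    (d n : ℕ) (hd : 1 ≤ d) (hn : 1 ≤ n)
    (T p θ κ₀ : ℝ) (hT : 0 < T) (hp : 1 < p) (hθ : 0 ≤ θ) (hκ₀ : 0 < κ₀)
    (b : Euc d → Euc d) (σ : Euc d → Matrix (Fin d) (Fin n) ℝ)
    (hbLip : ∃ K : ℝ≥0, LipschitzWith K b) (hbBdd : ∃ C, ∀ y, ‖b y‖ ≤ C)
    (hσLip : ∃ K, ∀ y y' : Euc d, ∀ i k, |σ y i k - σ y' i k| ≤ K * ‖y - y'‖)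
    (hσBdd : ∃ C, ∀ y i k, |σ y i k| ≤ C)
    (hell : ∃ ν > 0, ∀ (y : Euc d) (z : Fin d → ℝ),
      ν * ∑ i, z i ^ 2 ≤ ∑ i, ∑ j, (∑ k, σ y i k * σ y j k) * z j * z i)
    (η lam gam : Euc d → ℝ)
    (hηC2 : ContDiff ℝ 2 η)
    (hηBdd : ∃ C, ∀ y, |η y| ≤ C ∧ ‖fderiv ℝ η y‖ ≤ C ∧ ‖fderiv ℝ (fderiv ℝ η) y‖ ≤ C)
    (hηκ : ∀ y, κ₀ ≤ η y)
    (hlamCont : Continuous lam) (hlam0 : ∀ y, 0 ≤ lam y) (hlamBdd : ∃ C, ∀ y, lam y ≤ C)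
    (hgamCont : Continuous gam) (hgam0 : ∀ y, 0 ≤ gam y) (hgamBdd : ∃ C, ∀ y, gam y ≤ C)
    (v : ℝ → Euc d → ℝ)
    (hv0 : ∀ t ∈ Set.Ico (0 : ℝ) T, ∀ y, 0 ≤ v t y)
    (hvC12 : IsC12On (Set.Ico 0 T) v)
    (hvPG : PolyGrowthOn 0 T v)
    (hpde : ∀ t ∈ Set.Ico (0 : ℝ) T, ∀ y,
      partialT (Set.Ico 0 T) v t y + Lop b σ v t y + hjbF p θ η lam gam y (v t y) = 0)
    (hblow : BlowsUpLocUnif 0 T v) :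
    ∃ C > 0, ∃ δ, 0 < δ ∧ δ < T ∧
      ∀ t, T - δ ≤ t → t < T → ∀ y,
        |(T - t) ^ (p - 1) * v t y - η y| ≤ C * (T - t) := by
  obtain ⟨Cb, hCb⟩ := hbBdd
  obtain ⟨Cσ, hCσ⟩ := hσBdd
  obtain ⟨Cη, hCη⟩ := hηBdd
  obtain ⟨Cl, hCl⟩ := hlamBdd
  obtain ⟨K, hK⟩ := gch_LL (b := b) (σ := σ) hCσ hCb
  obtain ⟨M, hM0, hM⟩ := LL_bound (b := b) (σ := σ) hCσ hCb (f := η)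
    (fun y => (hCη y).2.1) (fun y => (hCη y).2.2)
  obtain ⟨hvd, hvC2, hvcont, -, -⟩ := hvC12
  have ha : 0 < p - 1 := by linarith
  set a := p - 1 with hadef
  have hCl0 : 0 ≤ Cl := (hlam0 0).trans (hCl 0)
  have hηpos : ∀ y, 0 < η y := fun y => hκ₀.trans_le (hηκ y)
  have hηle : ∀ y, η y ≤ Cη := fun y => (le_abs_self _).trans (hCη y).1
  have hCη0 : 0 < Cη := (hηpos 0).trans_le (hηle 0)
  set C := M + Cl + θ * Cη + 1 with hC
  have hCpos : 0 < C := by positivity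
  set δ := min (1 / 2) (T / 2) with hδ
  have hδ0 : 0 < δ := by positivity
  have hδ1 : δ ≤ 1 / 2 := min_le_left _ _
  have hδT : δ ≤ T / 2 := min_le_right _ _
  have hvt : ∀ t y, T - δ ≤ t → t < T →
      HasDerivAt (fun r => v r y) (partialT (Set.Ico 0 T) v t y) t := by
    intro t y h1 h2
    have hmem : t ∈ Set.Ico 0 T := ⟨by linarith, h2⟩
    exact (hvd t hmem y).hasDerivWithinAt.hasDerivAt (Ico_mem_nhds (by linarith) h2)
  have hcont' : ∀ U ≤ T, ContinuousOn (fun q : ℝ × Euc d => v q.1 q.2)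
      (Set.Ico (T - δ) U ×ˢ Set.univ) := by
    intro U hU
    refine hvcont.mono ?_
    rintro ⟨t, y⟩ ⟨ht, -⟩
    exact ⟨⟨by have := ht.1; simp only at this ⊢; linarith, ht.2.trans_le hU⟩, trivial⟩
  have hF : ∀ t y, T - δ ≤ t → t < T → partialT (Set.Ico 0 T) v t y + LL b σ (v t) y
      = - hjbF p θ η lam gam y (v t y) := by
    intro t y h1 h2
    have hmem : t ∈ Set.Ico 0 T := ⟨by linarith, h2⟩
    have := hpde t hmem y
    rw [Lop_eq b σ v t y (hvC2 t hmem)] at this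
    linarith
  have hexp : ∀ t, 0 < Real.exp (-|K| * T) ∧ (0 ≤ t → t ≤ T →
      Real.exp (-|K| * T) ≤ Real.exp (-K * t)) := by
    intro t
    refine ⟨Real.exp_pos _, fun h1 h2 => Real.exp_le_exp.2 ?_⟩
    nlinarith [le_abs_self K, abs_nonneg K]
  have hup : ∀ S, T - δ < S → S < T → ∀ ε > 0, ∀ t y, T - δ ≤ t → t < S →
      0 < phi η v a S C K ε (-1) t y := by
    intro S hS1 hS2 ε hε
    obtain ⟨Cv, hCv, q, -, hvq⟩ := hvPG S (by linarith) hS2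
    obtain ⟨R, hR0, hR⟩ := gch_dom hd (ε * Real.exp (-|K| * T)) Cv
      (mul_pos hε (Real.exp_pos _)) q
    have hlim : Filter.Tendsto (fun t => (S - t) ^ (-a) * κ₀) (nhdsWithin S (Set.Iio S))
        Filter.atTop := by
      refine Filter.Tendsto.atTop_mul_const hκ₀ ?_
      have h1 : Filter.Tendsto (fun t => S - t) (nhdsWithin S (Set.Iio S))
          (nhdsWithin 0 (Set.Ioi 0)) := by
        refine tendsto_nhdsWithin_iff.2 ⟨?_, ?_⟩
        · have : ContinuousAt (fun t => S - t) S := by fun_prop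
          simpa using this.tendsto.mono_left nhdsWithin_le_nhds
        · filter_upwards [self_mem_nhdsWithin] with t ht
          simpa using ht
      exact (tendsto_rpow_neg_nhdsGT_zero (by linarith)).comp h1
    obtain ⟨s, hs, hsS⟩ := (mem_nhdsLT_iff_exists_Ico_subset).1
      (hlim.eventually (Filter.eventually_gt_atTop (Cv * (1 + R ^ q))))
    have hg := gch_pos (d := d)
    refine core (b := b) (σ := σ) hηC2 (le_refl S) hε hK
      (fun t h1 h2 => hvC2 t ⟨by linarith, by linarith⟩) (hcont' S hS2.le)
      (fun t y h1 h2 => hvt t y h1 (by linarith)) R s hs ?_ ?_ ?_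
    · intro t y h1 h2 hy
      have hτ : 0 < S - t := by linarith
      have e1 := hR y hy
      have e2 := (le_abs_self _).trans (hvq t (by linarith) h2.le y)
      have e3 := (hexp t).2 (by linarith) (by linarith)
      have e4 : ε * Real.exp (-|K| * T) * gch y ≤ ε * Real.exp (-K * t) * gch y := by
        have := hg y
        gcongr
      have e5 : 0 < (S - t) ^ (-a) * η y := mul_pos (by positivity) (hηpos y)
      have e6 : 0 < C * ((S - t) ^ (-a) * (S - t)) := by positivity
      unfold phi
      linarith
    · intro t y hst h1 h2 hy
      have hτ : 0 < S - t := by linarith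
      have e1 : Cv * (1 + R ^ q) < (S - t) ^ (-a) * κ₀ := hsS ⟨hst, h2⟩
      have e2 := (le_abs_self _).trans (hvq t (by linarith) h2.le y)
      have e3 : Cv * (1 + ‖y‖ ^ q) ≤ Cv * (1 + R ^ q) := by gcongr
      have e4 : 0 ≤ ε * Real.exp (-K * t) * gch y := by
        have := hg y
        positivity
      have e5 : (S - t) ^ (-a) * κ₀ ≤ (S - t) ^ (-a) * η y := by
        have := hηκ y
        gcongr
      have e6 : 0 < C * ((S - t) ^ (-a) * (S - t)) := by positivity
      unfold phi
      linarith
    · intro t y h1 h2 hle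
      have hτ : 0 < S - t := by linarith
      have e4 : 0 ≤ ε * Real.exp (-K * t) * gch y := by
        have := hg y
        positivity
      unfold phi at hle
      have hx : (S - t) ^ (-a) * (η y + C * (S - t)) ≤ v t y := by linarith
      have hsup := super_alg hτ ha (hηpos y) (u := η y + C * (S - t)) (by nlinarith) hx
      have hth := third_bds ha hθ (hgam0 y) (hv0 t ⟨by linarith, by linarith⟩ y)
      have hone : 1 ≤ (S - t) ^ (-a) :=
        Real.one_le_rpow_of_pos_of_le_one_of_nonpos hτ (by linarith) (by linarith)
      rw [hF t y h1 (by linarith)]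
      unfold hjbF
      rw [← hadef]
      have hl := hCl y
      have hLη := (le_abs_self _).trans (hM y)
      have hθη : 0 ≤ θ * Cη := by positivity
      have hfin : Cl + (S - t) ^ (-a) * (LL b σ η y - C) < 0 := by nlinarith
      linarith
  have hlow : ∀ S, T < S → ∀ ε > 0, ∀ t y, T - δ ≤ t → t < T →
      0 < phi η v a S C K ε 1 t y := by
    intro S hS ε hε
    have hg := gch_pos (d := d)
    set B := (S - T) ^ (-a) * Cη with hB
    have hST : 0 < S - T := by linarith
    have hwB : ∀ t y, t < T → (S - t) ^ (-a) * η y ≤ B := by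
      intro t y ht
      have h1 : (S - t) ^ (-a) ≤ (S - T) ^ (-a) :=
        Real.rpow_le_rpow_of_nonpos hST (by linarith) (by linarith)
      have := hηle y
      have := (hηpos y).le
      rw [hB]
      gcongr
    obtain ⟨R, hR0, hR⟩ := gch_dom hd (ε * Real.exp (-|K| * T)) B
      (mul_pos hε (Real.exp_pos _)) 1
    obtain ⟨s, hs0, hsT, hsb⟩ := hblow (Metric.closedBall 0 R) (isCompact_closedBall _ _) B
    refine core (b := b) (σ := σ) hηC2 hS.le hε hK
      (fun t h1 h2 => hvC2 t ⟨by linarith, by linarith⟩) (hcont' T le_rfl)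
      (fun t y h1 h2 => hvt t y h1 (by linarith)) R s hsT ?_ ?_ ?_
    · intro t y h1 h2 hy
      have hτ : 0 < S - t := by linarith
      have e1 := hR y hy
      have e2 := hwB t y h2
      have e3 := (hexp t).2 (by linarith) (by linarith)
      have e4 : ε * Real.exp (-|K| * T) * gch y ≤ ε * Real.exp (-K * t) * gch y := by
        have := hg y
        gcongr
      have e5 := hv0 t ⟨by linarith, h2⟩ y
      have e6 : 0 < C * ((S - t) ^ (-a) * (S - t)) := by positivity
      have e7 : 0 ≤ B * ‖y‖ ^ 1 := by positivity
      unfold phi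
      linarith
    · intro t y hst h1 h2 hy
      have hτ : 0 < S - t := by linarith
      have e1 := hsb t hst h2 y (by simpa using hy)
      have e2 := hwB t y h2
      have e4 : 0 ≤ ε * Real.exp (-K * t) * gch y := by
        have := hg y
        positivity
      have e6 : 0 < C * ((S - t) ^ (-a) * (S - t)) := by positivity
      unfold phi
      linarith
    · intro t y h1 h2 hle
      have hτ : 0 < S - t := by linarith
      have e4 : 0 ≤ ε * Real.exp (-K * t) * gch y := by
        have := hg y
        positivity
      have hv := hv0 t ⟨by linarith, by linarith⟩ y
      unfold phi at hle
      have hx : v t y ≤ (S - t) ^ (-a) * (η y - C * (S - t)) := by linarith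
      have hpw : 0 < (S - t) ^ (-a) := by positivity
      have hu0 : 0 ≤ η y - C * (S - t) := by
        by_contra! hneg
        nlinarith
      have hCτ : 0 < C * (S - t) := by positivity
      have hsub := sub_alg hτ ha (hηpos y) (u := η y - C * (S - t)) (by linarith) hu0 hv hx
      have hth := third_bds ha hθ (hgam0 y) hv
      rw [hF t y h1 (by linarith)]
      unfold hjbF
      rw [← hadef]
      have hl := hlam0 y
      have hLη := (neg_le_abs _).trans (hM y)
      have hθv : θ * v t y ≤ θ * ((S - t) ^ (-a) * Cη) := by
        refine mul_le_mul_of_nonneg_left (hx.trans ?_) hθ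
        have := hηle y
        refine mul_le_mul_of_nonneg_left ?_ hpw.le
        linarith
      have hfin : (S - t) ^ (-a) * (θ * Cη - LL b σ η y - C) < 0 :=
        mul_neg_of_pos_of_neg hpw (by linarith)
      linarith
  refine ⟨C, hCpos, δ, hδ0, by linarith, fun t ht1 ht2 y => ?_⟩
  have hA : 0 ≤ (-1) * ((T - t) ^ a * v t y - η y) + C * (T - t) := by
    refine limit_arg (g := gch y) (D := Real.exp (-K * t)) ht2 (Set.Iio T) ?_
    filter_upwards [Ioo_mem_nhdsLT ht2] with S hS ε hε
    exact hup S (by linarith [hS.1]) hS.2 ε hε t y ht1 hS.1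
  have hBd : 0 ≤ 1 * ((T - t) ^ a * v t y - η y) + C * (T - t) := by
    refine limit_arg (g := gch y) (D := Real.exp (-K * t)) ht2 (Set.Ioi T) ?_
    filter_upwards [self_mem_nhdsWithin] with S hS ε hε
    exact hlow S hS ε hε t y ht1 ht2
  rw [abs_le]
  constructor <;> linarith
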